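/- arXiv:1712.02668 — 2 statements merged into one kernel-verified Lean document; each statement's English description precedes it below -/
import Mathlib

section
/- Let m ≥ 1 and let U ⊆ EuclideanSpace ℝ (Fin m) be open. Let V, ψ, β : U → ℝ with V and ψ twice continuously differentiable on U, V > 0 on U, and let c be a real constant and d > 0 a real constant. Suppose that on U: (i) ΔV = c²|∇ψ|²/V + V·β/d, and (ii) div(V^{−1}∇ψ) = 0, where Δ is the Euclidean Laplacian (sum of pure second partials), ∇ the Euclidean gradient, and div the Euclidean divergence. Then for each choice of sign, the function F± := V ± cψ − 1 satisfies div(V·∇F±) = |∇F±|² + V²·β/d on U. -/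
/-- The Euclidean Laplacian of a scalar function: sum of pure second partial
derivatives in the standard orthonormal basis directions. -/
noncomputable def euclideanLap {m : ℕ} (f : EuclideanSpace ℝ (Fin m) → ℝ)
    (x : EuclideanSpace ℝ (Fin m)) : ℝ :=
  ∑ i : Fin m, iteratedFDeriv ℝ 2 f x
    ![EuclideanSpace.single i (1 : ℝ), EuclideanSpace.single i (1 : ℝ)]

/-- The Euclidean divergence of a vector field. -/
noncomputable def euclideanDiv {m : ℕ}
    (X : EuclideanSpace ℝ (Fin m) → EuclideanSpace ℝ (Fin m))
    (x : EuclideanSpace ℝ (Fin m)) : ℝ :=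
  ∑ i : Fin m, fderiv ℝ X x (EuclideanSpace.single i (1 : ℝ)) i

theorem EuclideanSpace.gradient_apply {m : ℕ} (f : EuclideanSpace ℝ (Fin m) → ℝ)
    (x : EuclideanSpace ℝ (Fin m)) (i : Fin m) :
    gradient f x i = fderiv ℝ f x (EuclideanSpace.single i 1) := by
  have h : inner ℝ (gradient f x) (EuclideanSpace.single i (1 : ℝ))
      = fderiv ℝ f x (EuclideanSpace.single i 1) := by
    simp only [gradient, InnerProductSpace.toDual_symm_apply]
  rw [← h, EuclideanSpace.inner_single_right]
  simp

theorem differentiableAt_gradient {m : ℕ} {f : EuclideanSpace ℝ (Fin m) → ℝ}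
    {x : EuclideanSpace ℝ (Fin m)} (hf : ContDiffAt ℝ 2 f x) :
    DifferentiableAt ℝ (gradient f) x :=
  (InnerProductSpace.toDual ℝ
    (EuclideanSpace ℝ (Fin m))).symm.toContinuousLinearEquiv.differentiableAt.comp x
    ((hf.fderiv_right (m := 1) (by norm_num)).differentiableAt (by norm_num))

theorem fderiv_euclidean_apply {m : ℕ}
    {X : EuclideanSpace ℝ (Fin m) → EuclideanSpace ℝ (Fin m)}
    {x : EuclideanSpace ℝ (Fin m)} (hX : DifferentiableAt ℝ X x)
    (v : EuclideanSpace ℝ (Fin m)) (i : Fin m) :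
    fderiv ℝ X x v i = fderiv ℝ (fun y => X y i) x v := by
  have h := ((EuclideanSpace.proj i : EuclideanSpace ℝ (Fin m) →L[ℝ] ℝ).hasFDerivAt.comp x
    hX.hasFDerivAt).fderiv
  exact (DFunLike.congr_fun h v).symm

theorem euclideanDiv_gradient {m : ℕ} {f : EuclideanSpace ℝ (Fin m) → ℝ}
    {x : EuclideanSpace ℝ (Fin m)} (hf : ContDiffAt ℝ 2 f x) :
    euclideanDiv (gradient f) x = euclideanLap f x := by
  have hd : DifferentiableAt ℝ (fderiv ℝ f) x :=
    (hf.fderiv_right (m := 1) (by norm_num)).differentiableAt (by norm_num)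
  refine Finset.sum_congr rfl fun i _ => ?_
  rw [fderiv_euclidean_apply (differentiableAt_gradient hf), iteratedFDeriv_two_apply]
  simp only [EuclideanSpace.gradient_apply]
  rw [fderiv_clm_apply hd (differentiableAt_const _)]
  simp

theorem euclideanDiv_smul {m : ℕ} {g : EuclideanSpace ℝ (Fin m) → ℝ}
    {X : EuclideanSpace ℝ (Fin m) → EuclideanSpace ℝ (Fin m)}
    {x : EuclideanSpace ℝ (Fin m)} (hg : DifferentiableAt ℝ g x)
    (hX : DifferentiableAt ℝ X x) :
    euclideanDiv (fun y => g y • X y) x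
      = g x * euclideanDiv X x + inner ℝ (gradient g x) (X x) := by
  simp only [euclideanDiv, fderiv_fun_smul hg hX, PiLp.inner_apply,
    EuclideanSpace.gradient_apply, Finset.mul_sum, ← Finset.sum_add_distrib]
  refine Finset.sum_congr rfl fun i _ => ?_
  simp [mul_comm]

theorem euclideanDiv_add_const_smul {m : ℕ} (a : ℝ)
    {X Y : EuclideanSpace ℝ (Fin m) → EuclideanSpace ℝ (Fin m)}
    {x : EuclideanSpace ℝ (Fin m)} (hX : DifferentiableAt ℝ X x)
    (hY : DifferentiableAt ℝ Y x) :
    euclideanDiv (fun y => X y + a • Y y) x = euclideanDiv X x + a * euclideanDiv Y x := by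
  simp only [euclideanDiv, fderiv_fun_add hX (hY.fun_const_smul a), fderiv_fun_const_smul hY,
    Finset.mul_sum, ← Finset.sum_add_distrib]
  rfl

theorem gradient_add_const_mul_sub_const {m : ℕ} (a b k : ℝ)
    {f g : EuclideanSpace ℝ (Fin m) → ℝ} {x : EuclideanSpace ℝ (Fin m)}
    (hf : DifferentiableAt ℝ f x) (hg : DifferentiableAt ℝ g x) :
    gradient (fun z => f z + a * (b * g z) - k) x
      = gradient f x + (a * b) • gradient g x := by
  ext i
  have h := ((hf.hasFDerivAt.add ((hg.hasFDerivAt.const_mul b).const_mul a)).sub_const k).fderiv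
  simp only [PiLp.add_apply, PiLp.smul_apply, EuclideanSpace.gradient_apply]
  refine (DFunLike.congr_fun h _).trans ?_
  simp [mul_assoc]

theorem gradient_fun_inv {m : ℕ} {g : EuclideanSpace ℝ (Fin m) → ℝ}
    {x : EuclideanSpace ℝ (Fin m)} (hg : DifferentiableAt ℝ g x) (hx : g x ≠ 0) :
    gradient (fun y => (g y)⁻¹) x = (-(g x ^ 2)⁻¹) • gradient g x := by
  ext i
  have h := ((hasDerivAt_inv hx).comp_hasFDerivAt x hg.hasFDerivAt).fderiv
  simp only [PiLp.smul_apply, EuclideanSpace.gradient_apply]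
  exact DFunLike.congr_fun h _

/-- Euclidean-background divergence identity from Lemma 1:
if `ΔV = c²|∇ψ|²/V + Vβ/d` and `div(V⁻¹∇ψ) = 0` on an open set `U` with `V > 0`,
then `F± := V ± cψ − 1` satisfies `div(V∇F±) = |∇F±|² + V²β/d` on `U`. -/
theorem divergence_identity_for_F
    (m : ℕ) (hm : 1 ≤ m) (U : Set (EuclideanSpace ℝ (Fin m))) (hU : IsOpen U)
    (V ψ β : EuclideanSpace ℝ (Fin m) → ℝ) (c d : ℝ) (hd : 0 < d)
    (hVreg : ContDiffOn ℝ 2 V U) (hψreg : ContDiffOn ℝ 2 ψ U)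
    (hVpos : ∀ x ∈ U, 0 < V x)
    (heqV : ∀ x ∈ U,
      euclideanLap V x = c ^ 2 * ‖gradient ψ x‖ ^ 2 / V x + V x * β x / d)
    (heqψ : ∀ x ∈ U, euclideanDiv (fun y => (V y)⁻¹ • gradient ψ y) x = 0) :
    ∀ σ : ℝ, σ = 1 ∨ σ = -1 →
      ∀ x ∈ U,
        euclideanDiv
          (fun y => V y • gradient (fun z => V z + σ * (c * ψ z) - 1) y) x
        = ‖gradient (fun z => V z + σ * (c * ψ z) - 1) x‖ ^ 2
          + (V x) ^ 2 * β x / d := by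
  intro σ hσ x hx
  have hσ2 : σ ^ 2 = 1 := by rcases hσ with rfl | rfl <;> norm_num
  have hVat : ∀ y ∈ U, ContDiffAt ℝ 2 V y := fun y hy => hVreg.contDiffAt (hU.mem_nhds hy)
  have hψat : ∀ y ∈ U, ContDiffAt ℝ 2 ψ y := fun y hy => hψreg.contDiffAt (hU.mem_nhds hy)
  have hgrad : ∀ y ∈ U, gradient (fun z => V z + σ * (c * ψ z) - 1) y
      = gradient V y + (σ * c) • gradient ψ y := fun y hy =>
    gradient_add_const_mul_sub_const σ c 1 ((hVat y hy).differentiableAt (by norm_num))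
      ((hψat y hy).differentiableAt (by norm_num))
  have hV := (hVat x hx).differentiableAt (by norm_num)
  have hGV := differentiableAt_gradient (hVat x hx)
  have hGψ := differentiableAt_gradient (hψat x hx)
  have hne : V x ≠ 0 := (hVpos x hx).ne'
  have hcongr : (fun y => V y • gradient (fun z => V z + σ * (c * ψ z) - 1) y)
      =ᶠ[nhds x] fun y => V y • (gradient V y + (σ * c) • gradient ψ y) := by
    filter_upwards [hU.mem_nhds hx] with y hy
    rw [hgrad y hy]
  have hdiv : euclideanDiv (fun y => V y • gradient (fun z => V z + σ * (c * ψ z) - 1) y) x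
      = euclideanDiv (fun y => V y • (gradient V y + (σ * c) • gradient ψ y)) x := by
    simp only [euclideanDiv, hcongr.fderiv_eq]
  have hψeq := heqψ x hx
  rw [euclideanDiv_smul (hV.fun_inv hne) hGψ, gradient_fun_inv hV hne,
    real_inner_smul_left] at hψeq
  have hψdiv : V x * euclideanDiv (gradient ψ) x = inner ℝ (gradient V x) (gradient ψ x) := by
    field_simp at hψeq
    linarith
  have hVdiv : V x * euclideanDiv (gradient V) x
      = c ^ 2 * ‖gradient ψ x‖ ^ 2 + V x ^ 2 * β x / d := by
    rw [euclideanDiv_gradient (hVat x hx), heqV x hx]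
    field_simp
  rw [hdiv, hgrad x hx, euclideanDiv_smul hV (hGV.fun_add (hGψ.fun_const_smul _)),
    euclideanDiv_add_const_smul _ hGV hGψ, norm_add_sq_real, norm_smul, inner_add_right,
    real_inner_smul_right, real_inner_self_eq_norm_sq, mul_pow, Real.norm_eq_abs, sq_abs,
    mul_pow, hσ2]
  linear_combination hVdiv + σ * c * hψdiv
end

section
/- Let m ≥ 3 be a natural number, r₀ > 0 and v₀ a real number. Suppose v is continuous on {x ∈ EuclideanSpace ℝ (Fin m) : ‖x‖ ≥ r₀}, twice continuously differentiable and harmonic on the open exterior region {‖x‖ > r₀} (i.e. the sum of its pure second partial derivatives vanishes there), v(x) = v₀ for all x with ‖x‖ = r₀, and v(x) → 1 as ‖x‖ → ∞. Then v(x) = 1 + (v₀ − 1)·r₀^{m−2}·‖x‖^{−(m−2)} for all ‖x‖ ≥ r₀. -/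
open Filter Topology

open Laplacian InnerProductSpace

section LaplacianTools

variable {E : Type*} [NormedAddCommGroup E] [InnerProductSpace ℝ E]

/-- The derivative along a line of a function that is differentiable near the base point. -/
theorem ContDiffAt.eventually_hasDerivAt_line {f : E → ℝ} {x : E} (hf : ContDiffAt ℝ 2 f x)
    (e : E) :
    ∀ᶠ t in 𝓝 (0 : ℝ), HasDerivAt (fun t : ℝ => f (x + t • e)) (fderiv ℝ f (x + t • e) e) t := by
  have hline : Tendsto (fun t : ℝ => x + t • e) (𝓝 0) (𝓝 x) := by
    have : Continuous fun t : ℝ => x + t • e := by fun_prop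
    simpa using this.tendsto 0
  filter_upwards [hline.eventually (hf.eventually (by simp))] with t ht
  have hd : HasDerivAt (fun t : ℝ => x + t • e) e t := by
    simpa using ((hasDerivAt_id t).smul_const e).const_add x
  exact (ht.differentiableAt (by simp)).hasFDerivAt.comp_hasDerivAt t hd

/-- The second derivative along a line is the diagonal value of the second derivative. -/
theorem ContDiffAt.deriv_deriv_line {f : E → ℝ} {x : E} (hf : ContDiffAt ℝ 2 f x) (e : E) :
    deriv (deriv fun t : ℝ => f (x + t • e)) 0 = iteratedFDeriv ℝ 2 f x ![e, e] := by
  have h1 : deriv (fun t : ℝ => f (x + t • e)) =ᶠ[𝓝 0] fun t => fderiv ℝ f (x + t • e) e :=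
    (hf.eventually_hasDerivAt_line e).mono fun t ht => ht.deriv
  rw [h1.deriv_eq, iteratedFDeriv_two_apply]
  have hd : HasDerivAt (fun t : ℝ => x + t • e) e 0 := by
    simpa using ((hasDerivAt_id (0 : ℝ)).smul_const e).const_add x
  have hf' : HasFDerivAt (fderiv ℝ f) (fderiv ℝ (fderiv ℝ f) x) (x + (0 : ℝ) • e) := by
    rw [zero_smul, add_zero]
    exact ((hf.fderiv_right (m := 1) (by norm_num)).differentiableAt (by simp)).hasFDerivAt
  have h2 : HasDerivAt (fun t : ℝ => fderiv ℝ f (x + t • e)) (fderiv ℝ (fderiv ℝ f) x e) 0 :=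
    hf'.comp_hasDerivAt (0 : ℝ) hd
  have h3 : HasDerivAt (fun t : ℝ => fderiv ℝ f (x + t • e) e)
      (fderiv ℝ (fderiv ℝ f) x e e) 0 := by
    simpa using h2.clm_apply (hasDerivAt_const (0 : ℝ) e)
  exact h3.deriv

/-- At a local maximum the second derivative is nonpositive on the diagonal. -/
theorem IsLocalMax.iteratedFDeriv_two_nonpos {f : E → ℝ} {x : E} (hmax : IsLocalMax f x)
    (hf : ContDiffAt ℝ 2 f x) (e : E) : iteratedFDeriv ℝ 2 f x ![e, e] ≤ 0 := by
  rw [← hf.deriv_deriv_line e]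
  by_contra! hpos
  have hline : Continuous fun t : ℝ => x + t • e := by fun_prop
  have hmax' : IsLocalMax (fun t : ℝ => f (x + t • e)) 0 := by
    have : Tendsto (fun t : ℝ => x + t • e) (𝓝 0) (𝓝 x) := by simpa using hline.tendsto 0
    simpa [IsLocalMax, IsMaxFilter] using this.eventually hmax
  have hc : ContinuousAt (fun t : ℝ => f (x + t • e)) 0 :=
    (hf.eventually_hasDerivAt_line e).self_of_nhds.continuousAt
  have hmin := isLocalMin_of_deriv_deriv_pos hpos hmax'.deriv_eq_zero hc
  have hconst : (fun t : ℝ => f (x + t • e)) =ᶠ[𝓝 0] fun _ => f (x + (0 : ℝ) • e) := by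
    filter_upwards [hmax', hmin] with t h1 h2 using le_antisymm h1 h2
  rw [hconst.deriv.deriv_eq] at hpos
  simp at hpos

variable [FiniteDimensional ℝ E]

/-- At a local maximum the Laplacian is nonpositive. -/
theorem IsLocalMax.laplacian_nonpos {f : E → ℝ} {x : E} (hmax : IsLocalMax f x)
    (hf : ContDiffAt ℝ 2 f x) : Δ f x ≤ 0 := by
  rw [laplacian_eq_iteratedFDeriv_stdOrthonormalBasis]
  exact Finset.sum_nonpos fun i _ => hmax.iteratedFDeriv_two_nonpos hf _

/-- The Laplacian of a function of the squared norm. -/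
theorem laplacian_comp_norm_sq {ψ ψ' : ℝ → ℝ} {c : ℝ} {x : E}
    (hψ : ContDiffAt ℝ 2 ψ (‖x‖ ^ 2))
    (h1 : ∀ᶠ s in 𝓝 (‖x‖ ^ 2), HasDerivAt ψ (ψ' s) s) (h2 : HasDerivAt ψ' c (‖x‖ ^ 2)) :
    Δ (fun y : E => ψ (‖y‖ ^ 2)) x
      = 4 * c * ‖x‖ ^ 2 + 2 * Module.finrank ℝ E * ψ' (‖x‖ ^ 2) := by
  have hf : ContDiffAt ℝ 2 (fun y : E => ψ (‖y‖ ^ 2)) x :=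
    ContDiffAt.comp x hψ (contDiff_norm_sq ℝ).contDiffAt
  have key (e : E) (he : ‖e‖ = 1) : iteratedFDeriv ℝ 2 (fun y : E => ψ (‖y‖ ^ 2)) x ![e, e]
      = 4 * c * inner ℝ x e ^ 2 + 2 * ψ' (‖x‖ ^ 2) := by
    rw [← hf.deriv_deriv_line e]
    have hs (t : ℝ) : HasDerivAt (fun t : ℝ => ‖x + t • e‖ ^ 2) (2 * inner ℝ x e + 2 * t) t := by
      have hd : HasDerivAt (fun t : ℝ => x + t • e) e t := by
        simpa using ((hasDerivAt_id t).smul_const e).const_add x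
      convert hd.norm_sq using 1
      rw [inner_add_left, real_inner_smul_left, real_inner_self_eq_norm_sq, he]
      ring
    have hcont : Tendsto (fun t : ℝ => ‖x + t • e‖ ^ 2) (𝓝 0) (𝓝 (‖x‖ ^ 2)) := by
      simpa using (hs 0).continuousAt.tendsto
    have hd1 : deriv (fun t : ℝ => ψ (‖x + t • e‖ ^ 2)) =ᶠ[𝓝 0]
        fun t => ψ' (‖x + t • e‖ ^ 2) * (2 * inner ℝ x e + 2 * t) := by
      filter_upwards [hcont.eventually h1] with t ht
      exact (ht.comp t (hs t)).deriv
    rw [hd1.deriv_eq]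
    have h2' : HasDerivAt ψ' c (‖x + (0 : ℝ) • e‖ ^ 2) := by simpa using h2
    have hlin : HasDerivAt (fun t : ℝ => 2 * inner ℝ x e + 2 * t) 2 0 := by
      simpa using ((hasDerivAt_id (0 : ℝ)).const_mul 2).const_add (2 * inner ℝ x e)
    have := ((h2'.comp (0 : ℝ) (hs 0)).mul hlin).deriv
    simp only [Function.comp_apply, zero_smul, add_zero, mul_zero] at this
    refine Eq.trans this ?_
    ring
  rw [laplacian_eq_iteratedFDeriv_stdOrthonormalBasis]
  simp only [key _ ((stdOrthonormalBasis ℝ E).norm_eq_one _)]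
  rw [Finset.sum_add_distrib, ← Finset.mul_sum, OrthonormalBasis.sum_sq_inner_left]
  simp
  ring

/-- The Laplacian of the squared norm. -/
theorem laplacian_norm_sq (x : E) :
    Δ (fun y : E => ‖y‖ ^ 2) x = 2 * Module.finrank ℝ E := by
  have := laplacian_comp_norm_sq (ψ := fun s => s) (ψ' := fun _ => 1) (c := 0) (x := x)
    contDiffAt_id (Eventually.of_forall fun s => hasDerivAt_id s) (hasDerivAt_const _ _)
  simpa using this

/-- The fundamental solution `‖x‖ ^ (2 - d)` is harmonic away from the origin. -/
theorem laplacian_norm_sq_rpow {x : E} (hx : x ≠ 0) :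
    Δ (fun y : E => (‖y‖ ^ 2) ^ (1 - (Module.finrank ℝ E : ℝ) / 2)) x = 0 := by
  set p : ℝ := 1 - (Module.finrank ℝ E : ℝ) / 2 with hp
  have hpos : 0 < ‖x‖ ^ 2 := by positivity
  rw [laplacian_comp_norm_sq (ψ := fun s => s ^ p) (ψ' := fun s => p * s ^ (p - 1))
    (c := p * ((p - 1) * (‖x‖ ^ 2) ^ (p - 1 - 1)))
    (Real.contDiffAt_rpow_const_of_ne hpos.ne')
    ((eventually_gt_nhds hpos).mono fun s hs => Real.hasDerivAt_rpow_const (Or.inl hs.ne'))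
    ((Real.hasDerivAt_rpow_const (Or.inl hpos.ne')).const_mul p)]
  have hpow : (‖x‖ ^ 2) ^ (p - 1) = (‖x‖ ^ 2) ^ (p - 1 - 1) * ‖x‖ ^ 2 := by
    rw [← Real.rpow_add_one hpos.ne', sub_add_cancel]
  have hd : (Module.finrank ℝ E : ℝ) = 2 - 2 * p := by rw [hp]; ring
  rw [hpow, hd]
  ring

/-- Weak maximum principle on the exterior of a ball, for functions decaying at infinity. -/
theorem nonpos_of_laplacian_nonneg_exterior [Nontrivial E] {r : ℝ} {w : E → ℝ}
    (hcont : ContinuousOn w {x | r ≤ ‖x‖}) (hreg : ContDiffOn ℝ 2 w {x | r < ‖x‖})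
    (hlap : ∀ x, r < ‖x‖ → 0 ≤ Δ w x) (hbdry : ∀ x, ‖x‖ = r → w x ≤ 0)
    (hlim : Tendsto w (comap (fun x : E => ‖x‖) atTop) (𝓝 0)) {x : E} (hx : r ≤ ‖x‖) :
    w x ≤ 0 := by
  by_contra! hpos
  obtain ⟨R₀, hR₀⟩ : ∃ R₀, ∀ y : E, R₀ ≤ ‖y‖ → w y < w x / 2 := by
    have := hlim.eventually (eventually_lt_nhds (half_pos hpos))
    obtain ⟨R₀, h⟩ := eventually_atTop.1 (eventually_comap.1 this)
    exact ⟨R₀, fun y hy => h _ hy y rfl⟩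
  set R := max R₀ (‖x‖ + 1)
  have hxR : ‖x‖ < R := (lt_add_one _).trans_le (le_max_right _ _)
  have hR0 : 0 < R := (norm_nonneg x).trans_lt hxR
  set ε := w x / (4 * R ^ 2) with hε
  have hε0 : 0 < ε := by positivity
  have hεR : ε * R ^ 2 = w x / 4 := by rw [hε]; field_simp
  set g : E → ℝ := w + ε • fun y : E => ‖y‖ ^ 2 with hg
  have hgy (y : E) : g y = w y + ε * ‖y‖ ^ 2 := rfl
  have hK : IsCompact {y : E | r ≤ ‖y‖ ∧ ‖y‖ ≤ R} := by
    refine Metric.isCompact_of_isClosed_isBounded ?_ ?_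
    · exact (isClosed_le continuous_const continuous_norm).inter
        (isClosed_le continuous_norm continuous_const)
    · exact Metric.isBounded_closedBall.subset fun y hy => mem_closedBall_zero_iff.2 hy.2
  have hgc : ContinuousOn g {y : E | r ≤ ‖y‖ ∧ ‖y‖ ≤ R} := by
    refine (hcont.mono fun y hy => hy.1).add ?_
    exact Continuous.continuousOn (by fun_prop)
  obtain ⟨y, ⟨hry, hyR⟩, hmax⟩ := hK.exists_isMaxOn ⟨x, hx, hxR.le⟩ hgc
  have hxy : w x ≤ g y := by
    refine le_trans ?_ (hmax ⟨hx, hxR.le⟩)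
    rw [hgy]
    have : 0 ≤ ε * ‖x‖ ^ 2 := by positivity
    linarith
  have hεy : ε * ‖y‖ ^ 2 ≤ w x / 4 := by rw [← hεR]; gcongr
  have hry' : r < ‖y‖ := by
    refine lt_of_le_of_ne hry fun h => ?_
    have := hbdry y h.symm
    rw [hgy] at hxy
    linarith
  have hyR' : ‖y‖ < R := by
    refine lt_of_le_of_ne hyR fun h => ?_
    have := hR₀ y (h ▸ le_max_left _ _)
    rw [hgy] at hxy
    linarith
  have hnhds : {z : E | r ≤ ‖z‖ ∧ ‖z‖ ≤ R} ∈ 𝓝 y := by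
    filter_upwards [continuous_norm.continuousAt.eventually (eventually_gt_nhds hry'),
      continuous_norm.continuousAt.eventually (eventually_lt_nhds hyR')] with z h1 h2
    exact ⟨h1.le, h2.le⟩
  have hw : ContDiffAt ℝ 2 w y :=
    hreg.contDiffAt ((isOpen_lt continuous_const continuous_norm).mem_nhds hry')
  have hq : ContDiffAt ℝ 2 (fun y : E => ‖y‖ ^ 2) y := (contDiff_norm_sq ℝ).contDiffAt
  have hle : Δ g y ≤ 0 := (hmax.isLocalMax hnhds).laplacian_nonpos (hw.add (hq.const_smul ε))
  have hεq : ContDiffAt ℝ 2 (ε • fun y : E => ‖y‖ ^ 2) y := hq.const_smul ε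
  rw [hg, hw.laplacian_add hεq, laplacian_smul ε hq, laplacian_norm_sq, smul_eq_mul] at hle
  have hd : (0 : ℝ) < Module.finrank ℝ E := by exact_mod_cast Module.finrank_pos
  have : 0 < ε * (2 * Module.finrank ℝ E) := by positivity
  linarith [hlap y hry']

/-- A harmonic function on the exterior of a ball that vanishes on the sphere and at infinity
vanishes identically. -/
theorem eq_zero_of_laplacian_eq_zero_exterior [Nontrivial E] {r : ℝ} {w : E → ℝ}
    (hcont : ContinuousOn w {x | r ≤ ‖x‖}) (hreg : ContDiffOn ℝ 2 w {x | r < ‖x‖})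
    (hlap : ∀ x, r < ‖x‖ → Δ w x = 0) (hbdry : ∀ x, ‖x‖ = r → w x = 0)
    (hlim : Tendsto w (comap (fun x : E => ‖x‖) atTop) (𝓝 0)) {x : E} (hx : r ≤ ‖x‖) :
    w x = 0 := by
  refine le_antisymm (nonpos_of_laplacian_nonneg_exterior hcont hreg (fun y hy => (hlap y hy).ge)
    (fun y hy => (hbdry y hy).le) hlim hx) ?_
  have : (-w) x ≤ 0 := nonpos_of_laplacian_nonneg_exterior hcont.neg hreg.neg
    (fun y hy => by simp [laplacian_neg, hlap y hy]) (fun y hy => by simp [hbdry y hy])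
    (by rw [← neg_zero]; exact hlim.neg) hx
  simpa using this

end LaplacianTools


/-- Uniqueness for the exterior boundary value problem: if `v` is continuous on
`{‖x‖ ≥ r₀}`, twice continuously differentiable and harmonic on `{‖x‖ > r₀}`
(sum of pure second partials vanishes), equal to the constant `v₀` on the
boundary sphere `‖x‖ = r₀`, and tends to `1` at infinity, then
`v(x) = 1 + (v₀ − 1) r₀^{m−2} ‖x‖^{−(m−2)}` on `{‖x‖ ≥ r₀}`. -/
theorem exterior_bvp_uniqueness
    (m : ℕ) (hm : 3 ≤ m) (r₀ v₀ : ℝ) (hr₀ : 0 < r₀)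
    (v : EuclideanSpace ℝ (Fin m) → ℝ)
    (hcont : ContinuousOn v {x : EuclideanSpace ℝ (Fin m) | r₀ ≤ ‖x‖})
    (hreg : ContDiffOn ℝ 2 v {x : EuclideanSpace ℝ (Fin m) | r₀ < ‖x‖})
    (hharm : ∀ x : EuclideanSpace ℝ (Fin m), r₀ < ‖x‖ →
      ∑ i : Fin m, iteratedFDeriv ℝ 2 v x
        ![EuclideanSpace.single i (1 : ℝ), EuclideanSpace.single i (1 : ℝ)] = 0)
    (hbdry : ∀ x : EuclideanSpace ℝ (Fin m), ‖x‖ = r₀ → v x = v₀)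
    (hlim : Tendsto v (comap (fun x : EuclideanSpace ℝ (Fin m) => ‖x‖) atTop) (𝓝 1)) :
    ∀ x : EuclideanSpace ℝ (Fin m), r₀ ≤ ‖x‖ →
      v x = 1 + (v₀ - 1) * r₀ ^ (m - 2) * (‖x‖ ^ (m - 2))⁻¹ := by
  have hm0 : m - 2 ≠ 0 := by omega
  have : Nonempty (Fin m) := ⟨⟨0, by omega⟩⟩
  have hfr : Module.finrank ℝ (EuclideanSpace ℝ (Fin m)) = m := by simp
  set C : ℝ := (v₀ - 1) * r₀ ^ (m - 2) with hC
  set φ : EuclideanSpace ℝ (Fin m) → ℝ := fun x => (‖x‖ ^ (m - 2))⁻¹ with hφ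
  have hφ_rpow : φ = fun x => (‖x‖ ^ 2) ^
      (1 - (Module.finrank ℝ (EuclideanSpace ℝ (Fin m)) : ℝ) / 2) := by
    funext x
    simp only [hfr, hφ]
    rw [← Real.rpow_natCast_mul (norm_nonneg x), ← Real.rpow_natCast,
      ← Real.rpow_neg (norm_nonneg x), Nat.cast_sub (by omega)]
    congr 1
    push_cast
    ring
  have hφ_smooth {x : EuclideanSpace ℝ (Fin m)} (hx : r₀ ≤ ‖x‖) : ContDiffAt ℝ 2 φ x := by
    have hx0 : 0 < ‖x‖ := hr₀.trans_le hx
    exact ((contDiffAt_norm ℝ (norm_pos_iff.1 hx0)).pow _).inv (by positivity)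
  have hφ_lim : Tendsto φ (comap (fun x : EuclideanSpace ℝ (Fin m) => ‖x‖) atTop) (𝓝 0) :=
    ((tendsto_pow_atTop hm0).comp tendsto_comap).inv_tendsto_atTop
  have hv {x : EuclideanSpace ℝ (Fin m)} (hx : r₀ < ‖x‖) : ContDiffAt ℝ 2 v x :=
    hreg.contDiffAt ((isOpen_lt continuous_const continuous_norm).mem_nhds hx)
  have hv_lap {x : EuclideanSpace ℝ (Fin m)} (hx : r₀ < ‖x‖) : Δ v x = 0 := by
    rw [laplacian_eq_iteratedFDeriv_orthonormalBasis v (EuclideanSpace.basisFun (Fin m) ℝ)]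
    simpa using hharm x hx
  intro x hx
  have hw := eq_zero_of_laplacian_eq_zero_exterior (r := r₀) (w := v - ((fun _ => 1) + C • φ))
    (hcont.sub (continuousOn_const.add fun y hy =>
      ((hφ_smooth hy).const_smul C).continuousAt.continuousWithinAt))
    (fun y hy => ((hv hy).sub (contDiffAt_const.add
      ((hφ_smooth (le_of_lt hy)).const_smul C))).contDiffWithinAt)
    (fun y hy => by
      have hφy : ContDiffAt ℝ 2 φ y := hφ_smooth hy.le
      have hCφ : ContDiffAt ℝ 2 (C • φ) y := hφy.const_smul C
      have h1 : ContDiffAt ℝ 2 (fun _ : EuclideanSpace ℝ (Fin m) => (1 : ℝ)) y :=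
        contDiffAt_const
      have h1Cφ : ContDiffAt ℝ 2 ((fun _ => 1) + C • φ) y := h1.add hCφ
      rw [(hv hy).laplacian_sub h1Cφ, h1.laplacian_add hCφ, laplacian_smul C hφy, hv_lap hy,
        hφ_rpow, laplacian_norm_sq_rpow (norm_pos_iff.1 (hr₀.trans hy))]
      simp)
    (fun y hy => by
      simp only [Pi.sub_apply, Pi.add_apply, Pi.smul_apply, smul_eq_mul, hbdry y hy, hφ, hy, hC]
      field_simp
      ring)
    (by
      have h : (0 : ℝ) = 1 - (1 + C • 0) := by simp
      rw [h]
      exact hlim.sub (tendsto_const_nhds.add (hφ_lim.const_smul C)))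
    hx
  exact sub_eq_zero.1 hw
end
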